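/- Let p be an odd prime and let G be a non-abelian UCS p-group minimally generated by 3 elements (equivalently |G/Φ(G)| = p³). Then |G| = p⁶, and G belongs to exactly one of two isomorphism classes: one class consists of the groups of exponent p (the relatively free 3-generator group of exponent p and nilpotency class 2), and the other of the groups of exponent p². In particular: there is, up to isomorphism, exactly one 3-generator non-abelian UCS p-group of exponent p and exactly one of exponent p². -/

import Mathlib

/-- A finite `p`-group is a UCS group if it has exactly three characteristic
subgroups. -/
def IsUCS (p : ℕ) (G : Type*) [Group G] : Prop :=
  IsPGroup p G ∧ Nat.card {H : Subgroup G // H.Characteristic} = 3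

/-- `G` is a non-abelian UCS `p`-group minimally generated by `3` elements. -/
def IsUCS3Gen (p : ℕ) (G : Type*) [Group G] : Prop :=
  IsUCS p G ∧ ¬ (∀ a b : G, a * b = b * a) ∧
    Nat.card (G ⧸ frattini G) = p ^ 3

section FrattiniOfPGroup

variable {p : ℕ} [Fact p.Prime] {G : Type*} [Group G] [Finite G]

theorem IsPGroup.coatom_quotient (hG : IsPGroup p G) {M : Subgroup G} (hM : IsCoatom M) :
    M.Normal ∧ M.index = p := by
  have hnil : Group.IsNilpotent G := hG.isNilpotent
  have hn : M.Normal :=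
    Subgroup.NormalizerCondition.normal_of_coatom M Group.normalizerCondition_of_isNilpotent hM
  refine ⟨hn, ?_⟩
  have hq : IsPGroup p (G ⧸ M) := hG.to_quotient M
  have hnt : Nontrivial (G ⧸ M) := QuotientGroup.nontrivial_iff.mpr hM.1
  obtain ⟨n, hn0, hcard⟩ := (IsPGroup.nontrivial_iff_card hq).mp hnt
  obtain ⟨K, hK⟩ := Sylow.exists_subgroup_card_pow_prime (G := G ⧸ M) p (n := 1)
    (hcard ▸ pow_dvd_pow p hn0)
  have hle : M ≤ K.comap (QuotientGroup.mk' M) := by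
    intro x hx
    rw [Subgroup.mem_comap, QuotientGroup.mk'_apply, (QuotientGroup.eq_one_iff x).mpr hx]
    exact K.one_mem
  have hKtop : K = ⊤ := by
    rcases hM.le_iff.mp hle with h | h
    · rw [← Subgroup.comap_top (QuotientGroup.mk' M)] at h
      exact Subgroup.comap_injective (QuotientGroup.mk'_surjective M) h
    · exfalso
      have hbot : K = ⊥ := by
        rw [eq_bot_iff]
        intro y hy
        obtain ⟨x, rfl⟩ := QuotientGroup.mk'_surjective M y
        have : x ∈ M := h ▸ hy
        exact (QuotientGroup.eq_one_iff x).mpr this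
      rw [hbot] at hK
      simp only [Subgroup.card_bot, pow_one] at hK
      exact (Fact.out : p.Prime).one_lt.ne hK
  rw [hKtop, Subgroup.card_top, pow_one] at hK
  exact hK

theorem IsPGroup.pow_mem_frattini (hG : IsPGroup p G) (g : G) : g ^ p ∈ frattini G := by
  simp only [frattini, Order.radical, Subgroup.mem_iInf]
  intro M hM
  obtain ⟨hn, hi⟩ := hG.coatom_quotient hM
  exact hi ▸ M.pow_index_mem g

theorem IsPGroup.commutator_le_frattini (hG : IsPGroup p G) : commutator G ≤ frattini G := by
  simp only [frattini, Order.radical, le_iInf_iff]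
  intro M hM
  obtain ⟨hn, hi⟩ := hG.coatom_quotient hM
  have : IsCyclic (G ⧸ M) := isCyclic_of_prime_card (p := p) hi
  rw [← Subgroup.Normal.quotient_commutative_iff_commutator_le]
  exact ⟨⟨fun a b => IsCyclic.commGroup.mul_comm a b⟩⟩

theorem frattini_ne_top [Nontrivial G] : frattini G ≠ ⊤ := by
  intro h
  have : (⊥ : Subgroup G) = ⊤ := frattini_nongenerating (by rw [h, bot_sup_eq])
  exact bot_ne_top this

end FrattiniOfPGroup

theorem Subgroup.characteristic_trichotomy {G : Type*} [Group G]
    (h3 : Nat.card {H : Subgroup G // H.Characteristic} = 3) {A C : Subgroup G}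
    (hA : A.Characteristic) (hA0 : A ≠ ⊥) (hA1 : A ≠ ⊤) (hC : C.Characteristic) :
    C = ⊥ ∨ C = A ∨ C = ⊤ := by
  by_contra! hcon
  obtain ⟨h0, hCA, h1⟩ := hcon
  have : Finite {H : Subgroup G // H.Characteristic} := Nat.finite_of_card_ne_zero (by omega)
  have hbt : (⊥ : Subgroup G) ≠ ⊤ := by
    rintro hbt
    exact hA0 (eq_bot_iff.mpr (hbt ▸ le_top))
  let s : Finset (Subgroup G) := by classical exact {⊥, A, C, ⊤}
  have hs : s.card = 4 := by
    classical
    simp only [s]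
    rw [Finset.card_insert_of_notMem, Finset.card_insert_of_notMem, Finset.card_insert_of_notMem,
      Finset.card_singleton]
    · simpa using h1
    · simpa using ⟨hCA.symm, hA1⟩
    · simpa using ⟨hA0.symm, h0.symm, hbt⟩
  have hle : (s : Set (Subgroup G)).ncard ≤ {H : Subgroup G | H.Characteristic}.ncard := by
    refine Set.ncard_le_ncard ?_ ‹_›
    intro H hH
    simp only [s, Finset.coe_insert, Finset.coe_singleton, Set.mem_insert_iff,
      Set.mem_singleton_iff] at hH
    rcases hH with rfl | rfl | rfl | rfl
    · exact Subgroup.botCharacteristic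
    · exact hA
    · exact hC
    · exact Subgroup.topCharacteristic
  rw [Set.ncard_coe_finset, hs] at hle
  have : {H : Subgroup G | H.Characteristic}.ncard = 3 := h3
  omega

section UCS

open scoped commutatorElement

variable {p : ℕ} [Fact p.Prime] {G : Type*} [Group G] [Finite G]

omit [Fact p.Prime] [Finite G] in
theorem IsUCS3Gen.nontrivial (h : IsUCS3Gen p G) : Nontrivial G := by
  by_contra hn
  rw [not_nontrivial_iff_subsingleton] at hn
  exact h.2.1 fun a b => Subsingleton.elim _ _

omit [Fact p.Prime] [Finite G] in
theorem IsUCS3Gen.commutator_ne_bot (h : IsUCS3Gen p G) : commutator G ≠ ⊥ := by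
  intro hc
  refine h.2.1 fun a b => ?_
  have : ⁅a, b⁆ ∈ commutator G :=
    Subgroup.commutator_mem_commutator (Subgroup.mem_top a) (Subgroup.mem_top b)
  rw [hc, Subgroup.mem_bot] at this
  exact commutatorElement_eq_one_iff_mul_comm.mp this

theorem IsUCS3Gen.commutator_eq (h : IsUCS3Gen p G) : commutator G = frattini G := by
  have := h.nontrivial
  have hle := h.1.1.commutator_le_frattini
  have hne : frattini G ≠ ⊥ := fun h0 => h.commutator_ne_bot (eq_bot_iff.mpr (h0 ▸ hle))
  rcases Subgroup.characteristic_trichotomy h.1.2 frattini_characteristic hne frattini_ne_top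
    (C := commutator G) inferInstance with h' | h' | h'
  · exact absurd h' h.commutator_ne_bot
  · exact h'
  · exact absurd (eq_top_iff.mpr (h' ▸ hle)) frattini_ne_top

theorem IsUCS3Gen.characteristic_cases (h : IsUCS3Gen p G) {C : Subgroup G}
    (hC : C.Characteristic) : C = ⊥ ∨ C = frattini G ∨ C = ⊤ := by
  have := h.nontrivial
  exact Subgroup.characteristic_trichotomy h.1.2 frattini_characteristic
    (h.commutator_eq ▸ h.commutator_ne_bot) frattini_ne_top hC

theorem IsUCS3Gen.center_eq (h : IsUCS3Gen p G) : Subgroup.center G = frattini G := by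
  have := h.nontrivial
  rcases h.characteristic_cases (C := Subgroup.center G) inferInstance with h' | h' | h'
  · exact absurd h' (IsPGroup.bot_lt_center h.1.1).ne'
  · exact h'
  · refine absurd (fun a b => ?_) h.2.1
    exact Subgroup.mem_center_iff.mp (h' ▸ trivial : b ∈ Subgroup.center G) a

end UCS

section ClassTwo

open scoped commutatorElement

variable {G : Type*} [Group G]

theorem commutatorElement_mul_left_of_central (hc : ∀ a b : G, ⁅a, b⁆ ∈ Subgroup.center G)
    (a b c : G) : ⁅a * b, c⁆ = ⁅a, c⁆ * ⁅b, c⁆ := by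
  have h := Subgroup.mem_center_iff.mp (hc b c)
  have : ⁅a * b, c⁆ = a * ⁅b, c⁆ * c * a⁻¹ * c⁻¹ := by simp [commutatorElement_def, mul_assoc]
  rw [this, h a]
  simp only [commutatorElement_def a c, mul_assoc]
  rw [← h]
  simp only [mul_assoc]

theorem commutatorElement_mul_right_of_central (hc : ∀ a b : G, ⁅a, b⁆ ∈ Subgroup.center G)
    (a b c : G) : ⁅a, b * c⁆ = ⁅a, b⁆ * ⁅a, c⁆ := by
  rw [← commutatorElement_inv, commutatorElement_mul_left_of_central hc, mul_inv_rev,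
    commutatorElement_inv, commutatorElement_inv]
  exact Subgroup.mem_center_iff.mp (hc a b) _

theorem mul_pow_of_central_commutator (hc : ∀ a b : G, ⁅a, b⁆ ∈ Subgroup.center G)
    (a b : G) (n : ℕ) : (a * b) ^ n = a ^ n * b ^ n * ⁅b, a⁆ ^ n.choose 2 := by
  have hz : ∀ (g : G) (k : ℕ), g * ⁅b, a⁆ ^ k = ⁅b, a⁆ ^ k * g := fun g k =>
    Subgroup.mem_center_iff.mp (pow_mem (hc b a) k) g
  have hswap : ∀ k : ℕ, b ^ k * a = a * b ^ k * ⁅b, a⁆ ^ k := by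
    intro k
    induction k with
    | zero => simp
    | succ k ih =>
      have hb : b * a = ⁅b, a⁆ ^ 1 * (a * b) := by simp [commutatorElement_def, mul_assoc]
      rw [pow_succ b, mul_assoc, hb, ← mul_assoc (b ^ k), hz, mul_assoc, ← mul_assoc (b ^ k), ih,
        pow_add, ← hz, mul_assoc (a * b ^ k), ← hz b]
      simp only [mul_assoc]
  induction n with
  | zero => simp
  | succ n ih =>
    rw [pow_succ, ih, mul_assoc, ← hz (a * b), Nat.choose_succ_succ' n 1, Nat.choose_one_right,
      pow_add ⁅b, a⁆ n, ← mul_assoc, ← mul_assoc, mul_assoc (a ^ n), hswap, pow_succ a, pow_succ b]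
    simp only [mul_assoc]
    rw [← mul_assoc _ b, ← hz b]
    simp only [mul_assoc]

end ClassTwo

section Coordinates

open scoped Matrix commutatorElement

theorem exists_mulEquiv_of_card_eq_prime_pow {p : ℕ} [Fact p.Prime] {Q : Type*} [CommGroup Q]
    {n : ℕ} (hcard : Nat.card Q = p ^ n) (hpow : ∀ x : Q, x ^ p = 1) :
    Nonempty (Additive Q ≃+ (Fin n → ZMod p)) := by
  let : Module (ZMod p) (Additive Q) := AddCommGroup.zmodModule (n := p) hpow
  have hp1 := (Fact.out : p.Prime).one_lt
  have : Finite Q := Nat.finite_of_card_ne_zero (by rw [hcard]; positivity)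
  have : Finite (Additive Q) := ‹Finite Q›
  have : Module.Finite (ZMod p) (Additive Q) := Module.Finite.of_finite
  have hr : Module.finrank (ZMod p) (Additive Q) = n := by
    have h := Module.natCard_eq_pow_finrank (K := ZMod p) (V := Additive Q)
    rw [Nat.card_zmod, show Nat.card (Additive Q) = p ^ n from hcard] at h
    exact (Nat.pow_right_injective hp1 h).symm
  have hr' : Module.finrank (ZMod p) (Additive Q) = Module.finrank (ZMod p) (Fin n → ZMod p) := by
    rw [hr, Module.finrank_fin_fun]
  exact ⟨(LinearEquiv.ofFinrankEq _ _ hr').toAddEquiv⟩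

theorem exists_extension_of_pow_eq_one {p : ℕ} [Fact p.Prime] {Z : Type*} [CommGroup Z]
    (hpow : ∀ x : Z, x ^ p = 1) {n : ℕ} (c : Fin n → Z) :
    ∃ f : (Fin n → ZMod p) → Z, (∀ a b, f (a + b) = f a * f b) ∧
      ∀ i, f (Pi.single i 1) = c i := by
  let : Module (ZMod p) (Additive Z) := AddCommGroup.zmodModule (n := p) hpow
  let L : (Fin n → ZMod p) →ₗ[ZMod p] Additive Z :=
    (Pi.basisFun (ZMod p) (Fin n)).constr (ZMod p) (fun i => Additive.ofMul (c i))
  refine ⟨fun v => (L v).toMul, fun a b => by simp, fun i => ?_⟩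
  have := (Pi.basisFun (ZMod p) (Fin n)).constr_basis (ZMod p) (fun i => Additive.ofMul (c i)) i
  rw [Pi.basisFun_apply] at this
  exact congrArg Additive.toMul this

/-- Coordinates for a group of nilpotency class two with `3`-dimensional central quotient and
center over `ZMod p`, in which commutators are given by the cross product. -/
structure CommutatorCoordinates (p : ℕ) (G : Type*) [Group G] where
  /-- the coordinates modulo the center -/
  coord : G → Fin 3 → ZMod p
  /-- the parametrization of the center -/
  cen : (Fin 3 → ZMod p) → G
  /-- the `p`-th power map in coordinates -/
  power : (Fin 3 → ZMod p) →ₗ[ZMod p] (Fin 3 → ZMod p)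
  coord_mul : ∀ g h, coord (g * h) = coord g + coord h
  coord_surjective : Function.Surjective coord
  cen_add : ∀ a b, cen (a + b) = cen a * cen b
  cen_injective : Function.Injective cen
  coord_eq_zero : ∀ g, coord g = 0 ↔ ∃ v, cen v = g
  mul_swap : ∀ g h, g * h = cen (coord g ⨯₃ coord h) * (h * g)
  pow_eq : ∀ g, g ^ p = cen (power (coord g))

end Coordinates

section CrossProductLemmas

open scoped Matrix

theorem exists_smul_eq_cross_of_dotProduct_eq_zero {F : Type*} [Field F] {u a b : Fin 3 → F}
    (hu : u ≠ 0) (ha : u ⬝ᵥ a = 0) (hb : u ⬝ᵥ b = 0) : ∃ t : F, a ⨯₃ b = t • u := by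
  obtain ⟨i, hi⟩ := Function.ne_iff.mp hu
  refine ⟨(a ⨯₃ b) i / u i, ?_⟩
  have h0 : u ⨯₃ (a ⨯₃ b) = 0 := by
    rw [cross_cross_eq_smul_sub_smul', dotProduct_comm a, ha, hb, zero_smul, zero_smul, sub_zero]
  generalize a ⨯₃ b = w at *
  have e0 := congrFun h0 0
  have e1 := congrFun h0 1
  have e2 := congrFun h0 2
  simp only [cross_apply, Matrix.cons_val, Pi.zero_apply] at e0 e1 e2 hi
  ext j
  rw [Pi.smul_apply, smul_eq_mul, div_mul_eq_mul_div, eq_div_iff hi]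
  fin_cases i <;> fin_cases j <;> simp only [Fin.zero_eta, Fin.mk_one, Fin.reduceFinMk]
  · linear_combination e2
  · linear_combination -e1
  · linear_combination -e2
  · linear_combination e0
  · linear_combination e1
  · linear_combination -e0

theorem eq_smul_single_add {R : Type*} [CommRing R] (v : Fin 3 → R) :
    v = v 0 • Pi.single 0 1 + v 1 • Pi.single 1 1 + v 2 • Pi.single 2 1 := by
  ext i
  fin_cases i <;> simp

theorem single_cross_single_succ {R : Type*} [CommRing R] (i : Fin 3) :
    (Pi.single i 1 : Fin 3 → R) ⨯₃ Pi.single (i + 1) 1 = Pi.single (i + 2) 1 := by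
  rw [cross_apply]
  ext j
  fin_cases i <;> fin_cases j <;> simp

end CrossProductLemmas

section CoordinatesExist

open scoped Matrix commutatorElement

variable {p : ℕ} [Fact p.Prime]

theorem map_smul_eq_pow {G : Type*} [Group G] {n : ℕ} {f : (Fin n → ZMod p) → G}
    (hf : ∀ a b, f (a + b) = f a * f b) (t : ZMod p) (v : Fin n → ZMod p) :
    f (t • v) = f v ^ t.val := by
  have h0 : f 0 = 1 := by simpa using hf 0 0
  have : ∀ k : ℕ, f ((k : ZMod p) • v) = f v ^ k := by
    intro k
    induction k with
    | zero => simp [h0]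
    | succ k ih => rw [Nat.cast_succ, add_smul, one_smul, hf, ih, pow_succ]
  simpa using this t.val

theorem induction_of_coord {G : Type*} [Group G] {κ : G → Fin 3 → ZMod p}
    (hκ : ∀ g h, κ (g * h) = κ g + κ h) {x : Fin 3 → G} (hx : ∀ i, κ (x i) = Pi.single i 1)
    {P : G → Prop} (h0 : ∀ g, κ g = 0 → P g) (h1 : ∀ i, P (x i))
    (hmul : ∀ a b, P a → P b → P (a * b)) (g : G) : P g := by
  have hone : κ 1 = 0 := by simpa using hκ 1 1
  have hpow : ∀ i (k : ℕ), P (x i ^ k) ∧ κ (x i ^ k) = (k : ZMod p) • Pi.single i 1 := by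
    intro i k
    induction k with
    | zero => exact ⟨h0 _ (by simpa using hone), by simpa using hone⟩
    | succ k ih =>
      rw [pow_succ, hκ, ih.2, hx, Nat.cast_succ, add_smul, one_smul]
      exact ⟨hmul _ _ ih.1 (h1 i), rfl⟩
  set y := x 0 ^ (κ g 0).val * x 1 ^ (κ g 1).val * x 2 ^ (κ g 2).val with hy
  have hPy : P y := hmul _ _ (hmul _ _ (hpow 0 _).1 (hpow 1 _).1) (hpow 2 _).1
  have hκy : κ y = κ g := by
    rw [hy, hκ, hκ, (hpow 0 _).2, (hpow 1 _).2, (hpow 2 _).2]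
    simp only [ZMod.natCast_val, ZMod.cast_id', id]
    exact (eq_smul_single_add _).symm
  have : κ (y⁻¹ * g) = 0 := by
    have h := hκ y (y⁻¹ * g)
    rw [mul_inv_cancel_left, hκy] at h
    simpa using h
  simpa using hmul _ _ hPy (h0 _ this)

variable {G : Type*} [Group G] [Finite G]

omit [Fact p.Prime] [Finite G] in
theorem IsUCS3Gen.index_frattini (h : IsUCS3Gen p G) : (frattini G).index = p ^ 3 := h.2.2

theorem IsUCS3Gen.commutatorElement_mem_center (h : IsUCS3Gen p G) (a b : G) :
    ⁅a, b⁆ ∈ Subgroup.center G := by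
  rw [h.center_eq, ← h.commutator_eq]
  exact Subgroup.commutator_mem_commutator (Subgroup.mem_top a) (Subgroup.mem_top b)

theorem IsUCS3Gen.pow_eq_one_of_mem_center (h : IsUCS3Gen p G) {z : G}
    (hz : z ∈ Subgroup.center G) : z ^ p = 1 := by
  have hc := h.commutatorElement_mem_center
  have hpow : ∀ (a b : G) (n : ℕ), ⁅a ^ n, b⁆ = ⁅a, b⁆ ^ n := by
    intro a b n
    induction n with
    | zero => simp
    | succ n ih => rw [pow_succ, commutatorElement_mul_left_of_central hc, ih, pow_succ]
  rw [h.center_eq, ← h.commutator_eq, commutator_def, Subgroup.commutator_def] at hz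
  suffices z ∈ Subgroup.center G ∧ z ^ p = 1 from this.2
  induction hz using Subgroup.closure_induction with
  | mem z hz =>
    obtain ⟨a, _, b, _, rfl⟩ := hz
    refine ⟨hc a b, ?_⟩
    rw [← hpow, commutatorElement_eq_one_iff_mul_comm]
    have : a ^ p ∈ Subgroup.center G := h.center_eq ▸ h.1.1.pow_mem_frattini a
    exact (Subgroup.mem_center_iff.mp this b).symm
  | one => exact ⟨one_mem _, one_pow p⟩
  | mul x y _ _ hx hy =>
    have hxy : Commute x y := (Subgroup.mem_center_iff.mp hx.1 y).symm
    exact ⟨mul_mem hx.1 hy.1, by rw [hxy.mul_pow, hx.2, hy.2, one_mul]⟩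
  | inv x _ hx => exact ⟨inv_mem hx.1, by rw [inv_pow, hx.2, inv_one]⟩

theorem IsUCS3Gen.not_commutative_of_index_eq (h : IsUCS3Gen p G) {B : Subgroup G}
    (hB : B.index = p) : ¬ ∀ a ∈ B, ∀ b ∈ B, a * b = b * a := by
  intro hcomm
  have hp := (Fact.out : p.Prime)
  let S : Set (Subgroup G) := {B | B.index = p ∧ ∀ a ∈ B, ∀ b ∈ B, a * b = b * a}
  have hBS : B ∈ S := ⟨hB, hcomm⟩
  have hchar : (sInf S).Characteristic := by
    rw [Subgroup.characteristic_iff_le_comap]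
    intro φ x hx
    rw [Subgroup.mem_comap, Subgroup.mem_sInf]
    intro C hC
    refine Subgroup.mem_sInf.mp hx (C.comap φ.toMonoidHom)
      ⟨(Subgroup.index_comap_of_surjective C φ.surjective).trans hC.1, fun a ha b hb => ?_⟩
    apply φ.injective
    simpa using hC.2 _ ha _ hb
  have hne : sInf S ≠ ⊤ := by
    intro ht
    have : B = ⊤ := eq_top_iff.mpr (ht ▸ sInf_le hBS)
    rw [this, Subgroup.index_top] at hB
    exact hp.one_lt.ne hB
  have hle : sInf S ≤ frattini G := by
    rcases h.characteristic_cases hchar with h' | h' | h'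
    · rw [h']; exact bot_le
    · exact h'.le
    · exact absurd h' hne
  have hidx : ∀ C : Subgroup G, C ≤ frattini G → p ^ 3 ≤ C.index := fun C hC =>
    h.index_frattini ▸ Nat.le_of_dvd (Nat.pos_of_ne_zero C.index_ne_zero_of_finite)
      (Subgroup.index_dvd_of_le hC)
  obtain ⟨B', hB'S, hBB'⟩ : ∃ B' ∈ S, B' ≠ B := by
    by_contra! hall
    have hS : B ≤ sInf S := le_sInf fun C hC => (hall C hC).ge
    have := hidx B (hS.trans hle)
    rw [hB] at this
    have := Nat.pow_lt_pow_right hp.one_lt (show 1 < 3 by norm_num)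
    rw [pow_one] at this
    omega
  have hcent : B ⊓ B' ≤ Subgroup.center G := by
    intro z hz
    have hcard : ∀ C ∈ S, C ≤ Subgroup.centralizer {z} → Subgroup.centralizer {z} ≠ ⊤ →
        C = Subgroup.centralizer {z} := by
      intro C hC hle ht
      have hd := Subgroup.index_dvd_of_le hle
      rw [hC.1, Nat.dvd_prime hp] at hd
      rcases hd with hd | hd
      · exact absurd (Subgroup.index_eq_one.mp hd) ht
      · refine Subgroup.eq_of_le_of_card_ge hle ?_
        have h1 := C.card_mul_index
        have h2 := (Subgroup.centralizer {z}).card_mul_index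
        rw [hC.1] at h1
        rw [hd, ← h1] at h2
        exact (Nat.eq_of_mul_eq_mul_right hp.pos h2).le
    have hmem : ∀ C ∈ S, z ∈ C → C ≤ Subgroup.centralizer {z} := by
      intro C hC hzC y hy
      rw [Subgroup.mem_centralizer_singleton_iff]
      exact hC.2 _ hy _ hzC
    by_cases ht : Subgroup.centralizer {z} = ⊤
    · rw [Subgroup.mem_center_iff]
      intro y
      have : y ∈ Subgroup.centralizer {z} := ht ▸ Subgroup.mem_top y
      exact Subgroup.mem_centralizer_singleton_iff.mp this
    · exact absurd ((hcard B' hB'S (hmem _ hB'S hz.2) ht).trans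
        (hcard B hBS (hmem _ hBS hz.1) ht).symm) hBB'
  have h1 := hidx _ (h.center_eq ▸ hcent)
  have h2 := Subgroup.index_inf_le (H := B) (K := B')
  rw [hB, hB'S.1] at h2
  have := Nat.pow_lt_pow_right hp.one_lt (show 2 < 3 by norm_num)
  rw [sq] at this
  omega

omit [Finite G] in
theorem index_dotProduct_eq_zero {κ : G → Fin 3 → ZMod p}
    (hκ : ∀ g h, κ (g * h) = κ g + κ h) (hsurj : Function.Surjective κ)
    {u : Fin 3 → ZMod p} (hu : u ≠ 0) :
    ∃ B : Subgroup G, B.index = p ∧ ∀ g, g ∈ B ↔ u ⬝ᵥ κ g = 0 := by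
  let f : G →* Multiplicative (ZMod p) := MonoidHom.mk' (fun g => Multiplicative.ofAdd (u ⬝ᵥ κ g))
    fun a b => by rw [hκ, dotProduct_add, ofAdd_add]
  obtain ⟨i, hi⟩ := Function.ne_iff.mp hu
  have hf : Function.Surjective f := by
    intro t
    obtain ⟨g, hg⟩ := hsurj (Pi.single i (t.toAdd / u i))
    refine ⟨g, ?_⟩
    change Multiplicative.ofAdd (u ⬝ᵥ κ g) = t
    rw [hg, dotProduct_single, mul_div_cancel₀ _ hi, ofAdd_toAdd]
  refine ⟨f.ker, ?_, fun g => ?_⟩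
  · rw [Subgroup.index_ker, MonoidHom.range_eq_top.mpr hf, Subgroup.card_top]
    exact Nat.card_zmod p
  · rw [MonoidHom.mem_ker]
    exact ofAdd_eq_one

theorem IsUCS3Gen.nonempty_commutatorCoordinates (hodd : Odd p) (h : IsUCS3Gen p G) :
    Nonempty (CommutatorCoordinates p G) := by
  have hc := h.commutatorElement_mem_center
  let _ : CommGroup (G ⧸ frattini G) :=
    { (inferInstance : Group (G ⧸ frattini G)) with
      mul_comm := ((Subgroup.Normal.quotient_commutative_iff_commutator_le).mpr
        h.commutator_eq.le).is_comm.comm }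
  obtain ⟨e⟩ := exists_mulEquiv_of_card_eq_prime_pow (Q := G ⧸ frattini G) h.2.2 (fun x => by
    obtain ⟨g, rfl⟩ := QuotientGroup.mk'_surjective _ x
    rw [← map_pow]
    exact (QuotientGroup.eq_one_iff _).mpr (h.1.1.pow_mem_frattini g))
  let κ : G → Fin 3 → ZMod p := fun g => e (Additive.ofMul (g : G ⧸ frattini G))
  have hκ : ∀ g h, κ (g * h) = κ g + κ h := fun a b =>
    e.map_add (Additive.ofMul (a : G ⧸ frattini G)) (Additive.ofMul (b : G ⧸ frattini G))
  have hsurj : Function.Surjective κ :=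
    e.surjective.comp (QuotientGroup.mk'_surjective (frattini G))
  have hκ0 : ∀ g, κ g = 0 ↔ g ∈ Subgroup.center G := by
    intro g
    rw [h.center_eq, ← QuotientGroup.eq_one_iff]
    exact e.map_eq_zero_iff
  choose x hx using fun i : Fin 3 => hsurj (Pi.single i 1)
  let _ : CommGroup (Subgroup.center G) :=
    { (inferInstance : Group (Subgroup.center G)) with
      mul_comm := fun a b => Subtype.ext (Subgroup.mem_center_iff.mp b.2 a) }
  obtain ⟨f, hfadd, hf⟩ := exists_extension_of_pow_eq_one (Z := Subgroup.center G)
    (fun z => Subtype.ext (h.pow_eq_one_of_mem_center z.2))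
    (fun i => ⟨⁅x (i + 1), x (i + 2)⁆, hc _ _⟩)
  let ν : (Fin 3 → ZMod p) → G := fun v => f v
  have hν : ∀ a b, ν (a + b) = ν a * ν b := fun a b => congrArg Subtype.val (hfadd a b)
  have hν1 : ∀ i, ν (Pi.single i 1) = ⁅x (i + 1), x (i + 2)⁆ := fun i => congrArg Subtype.val (hf i)
  have hν0 : ν 0 = 1 := by simpa using hν 0 0
  have hνneg : ∀ a, ν (-a) = (ν a)⁻¹ := fun a => by
    rw [eq_inv_iff_mul_eq_one, ← hν, neg_add_cancel, hν0]
  have hνc : ∀ v, ν v ∈ Subgroup.center G := fun v => (f v).2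
  have hcen : ∀ a b, κ b = 0 → ⁅a, b⁆ = 1 := fun a b hb =>
    commutatorElement_eq_one_iff_mul_comm.mpr (Subgroup.mem_center_iff.mp ((hκ0 b).mp hb) a)
  have hsucc : ∀ i, ⁅x i, x (i + 1)⁆ = ν (Pi.single i 1 ⨯₃ Pi.single (i + 1) 1) := by
    intro i
    rw [single_cross_single_succ, hν1]
    fin_cases i <;> rfl
  have hcomm : ∀ a b, ⁅a, b⁆ = ν (κ a ⨯₃ κ b) := by
    intro a
    refine induction_of_coord hκ hx (fun b hb => by rw [hcen a b hb, hb, map_zero, hν0])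
      (fun i => ?_) fun b c hb hc' => by
        rw [commutatorElement_mul_right_of_central hc, hb, hc', hκ, map_add, hν]
    revert a
    refine induction_of_coord hκ hx (fun b hb => ?_) (fun j => ?_) fun b c hb hc' => by
      rw [commutatorElement_mul_left_of_central hc, hb, hc', hκ, map_add, LinearMap.add_apply, hν]
    · rw [← commutatorElement_inv, hcen _ b hb, hb, map_zero, LinearMap.zero_apply, hν0, inv_one]
    · rw [hx, hx]
      have hij : j = i ∨ i = j + 1 ∨ j = i + 1 := by revert i j; decide
      rcases hij with rfl | rfl | rfl
      · rw [commutatorElement_self, cross_self, hν0]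
      · exact hsucc j
      · rw [← commutatorElement_inv, hsucc, ← cross_anticomm, hνneg, inv_inv]
  have hνinj : Function.Injective ν := by
    intro a b hab
    by_contra hne
    have hu : a - b ≠ 0 := sub_ne_zero.mpr hne
    have hνu : ν (a - b) = 1 := by
      rw [sub_eq_add_neg, hν, hνneg, hab, mul_inv_cancel]
    obtain ⟨B, hB, hmem⟩ := index_dotProduct_eq_zero hκ hsurj hu
    refine h.not_commutative_of_index_eq hB fun g hg k hk => ?_
    obtain ⟨t, ht⟩ := exists_smul_eq_cross_of_dotProduct_eq_zero hu ((hmem g).mp hg)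
      ((hmem k).mp hk)
    rw [← commutatorElement_eq_one_iff_mul_comm, hcomm, ht, map_smul_eq_pow hν, hνu, one_pow]
  have hrange : ∀ z ∈ Subgroup.center G, ∃ v, ν v = z := by
    intro z hz
    let R : Subgroup G := (MonoidHom.mk' (fun v : Multiplicative (Fin 3 → ZMod p) => ν v.toAdd)
      fun a b => hν _ _).range
    rw [h.center_eq, ← h.commutator_eq, commutator_def] at hz
    have hle : ⁅(⊤ : Subgroup G), ⊤⁆ ≤ R :=
      Subgroup.commutator_le.mpr fun a _ b _ => ⟨Multiplicative.ofAdd _, (hcomm a b).symm⟩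
    obtain ⟨v, hv⟩ := hle hz
    exact ⟨v.toAdd, hv⟩
  have hpc : ∀ g : G, g ^ p ∈ Subgroup.center G := fun g =>
    h.center_eq ▸ h.1.1.pow_mem_frattini g
  choose w hw using fun i => hrange _ (hpc (x i))
  refine ⟨{
    coord := κ
    cen := ν
    power := Fintype.linearCombination (ZMod p) w
    coord_mul := hκ
    coord_surjective := hsurj
    cen_add := hν
    cen_injective := hνinj
    coord_eq_zero := fun g => (hκ0 g).trans
      ⟨fun hg => hrange g hg, fun ⟨v, hv⟩ => hv ▸ hνc v⟩
    mul_swap := fun a b => by rw [← hcomm]; simp [commutatorElement_def, mul_assoc]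
    pow_eq := ?_ }⟩
  refine induction_of_coord hκ hx (fun g hg => ?_) (fun i => ?_) fun a b ha hb => ?_
  · rw [hg, map_zero, hν0]
    exact h.pow_eq_one_of_mem_center ((hκ0 g).mp hg)
  · rw [hx, Fintype.linearCombination_apply_single, one_smul, hw]
  · have hdvd : p ∣ p.choose 2 := (Fact.out : p.Prime).dvd_choose_self two_ne_zero (by
      have := (Fact.out : p.Prime).two_le
      obtain ⟨k, hk⟩ := hodd
      omega)
    obtain ⟨k, hk⟩ := hdvd
    rw [mul_pow_of_central_commutator hc, hk, pow_mul, h.pow_eq_one_of_mem_center (hc b a), one_pow,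
      mul_one, ha, hb, hκ, map_add, hν]

end CoordinatesExist

section SymmetricPower

open scoped Matrix commutatorElement

theorem LinearMap.exists_dotProduct_sub_eq {F : Type*} [Field F]
    (q : (Fin 3 → F) →ₗ[F] (Fin 3 → F)) :
    ∃ s : Fin 3 → F, ∀ a b, q a ⬝ᵥ b - q b ⬝ᵥ a = s ⬝ᵥ a ⨯₃ b := by
  refine ⟨![q (Pi.single 1 1) 2 - q (Pi.single 2 1) 1, q (Pi.single 2 1) 0 - q (Pi.single 0 1) 2,
    q (Pi.single 0 1) 1 - q (Pi.single 1 1) 0], fun a b => ?_⟩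
  have hq : ∀ a, q a = a 0 • q (Pi.single 0 1) + a 1 • q (Pi.single 1 1) +
      a 2 • q (Pi.single 2 1) := fun a => by
    conv_lhs => rw [eq_smul_single_add a]
    simp
  rw [hq a, hq b, cross_apply]
  generalize q (Pi.single 0 1) = u
  generalize q (Pi.single 1 1) = v
  generalize q (Pi.single 2 1) = w
  simp only [dotProduct, Fin.sum_univ_three, Pi.add_apply, Pi.smul_apply, smul_eq_mul,
    Matrix.cons_val]
  ring

namespace CommutatorCoordinates

variable {p : ℕ} {G : Type*} [Group G] (c : CommutatorCoordinates p G)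

/-- The coordinates modulo the center, as a homomorphism. -/
def coordHom : G →* Multiplicative (Fin 3 → ZMod p) :=
  MonoidHom.mk' (fun g => Multiplicative.ofAdd (c.coord g)) fun a b => by
    rw [c.coord_mul, ofAdd_add]

/-- The parametrization of the center, as a homomorphism. -/
def cenHom : Multiplicative (Fin 3 → ZMod p) →* G :=
  MonoidHom.mk' (fun v => c.cen v.toAdd) fun _ _ => c.cen_add _ _

theorem coord_one : c.coord 1 = 0 := congrArg Multiplicative.toAdd c.coordHom.map_one

theorem coord_inv (g : G) : c.coord g⁻¹ = -c.coord g :=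
  congrArg Multiplicative.toAdd (c.coordHom.map_inv g)

theorem cen_zero : c.cen 0 = 1 := c.cenHom.map_one

theorem coord_cen (v : Fin 3 → ZMod p) : c.coord (c.cen v) = 0 :=
  (c.coord_eq_zero _).mpr ⟨v, rfl⟩

theorem commutatorElement_eq (g h : G) : ⁅g, h⁆ = c.cen (c.coord g ⨯₃ c.coord h) := by
  rw [commutatorElement_def, c.mul_swap g h]
  group

theorem mem_center_iff {g : G} : g ∈ Subgroup.center G ↔ c.coord g = 0 := by
  rw [Subgroup.mem_center_iff]
  constructor
  · intro h
    have hz : ∀ v, v ⨯₃ c.coord g = 0 := by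
      intro v
      obtain ⟨k, rfl⟩ := c.coord_surjective v
      refine c.cen_injective ?_
      rw [← c.commutatorElement_eq, c.cen_zero, commutatorElement_eq_one_iff_mul_comm, h]
    have h0 := hz (Pi.single 0 1)
    have h1 := hz (Pi.single 1 1)
    rw [cross_apply] at h0 h1
    ext i
    fin_cases i
    · simpa using congrFun h1 2
    · simpa using congrFun h0 2
    · simpa using congrFun h0 1
  · intro h k
    rw [← commutatorElement_eq_one_iff_mul_comm, c.commutatorElement_eq, h, map_zero, c.cen_zero]

theorem pow_sq_eq_one (c : CommutatorCoordinates p G) (g : G) : g ^ p ^ 2 = 1 := by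
  rw [sq, pow_mul, c.pow_eq g, c.pow_eq, c.coord_cen, map_zero, c.cen_zero]

variable [Fact p.Prime]

theorem card_eq (c : CommutatorCoordinates p G) : Nat.card G = p ^ 6 := by
  have hV : Nat.card (Multiplicative (Fin 3 → ZMod p)) = p ^ 3 := by
    change Nat.card (Fin 3 → ZMod p) = p ^ 3
    rw [Nat.card_fun, Nat.card_zmod, Nat.card_fin]
  have hker : c.coordHom.ker = c.cenHom.range := by
    ext g
    exact (c.coord_eq_zero g).trans ⟨fun ⟨v, hv⟩ => ⟨.ofAdd v, hv⟩, fun ⟨v, hv⟩ => ⟨v.toAdd, hv⟩⟩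
  have hinj : Function.Injective c.cenHom := fun a b hab => c.cen_injective hab
  have hsurj : Function.Surjective c.coordHom := c.coord_surjective
  rw [← c.coordHom.ker.card_mul_index, Subgroup.index_ker, MonoidHom.range_eq_top.mpr hsurj,
    Subgroup.card_top, hV, hker, ← Nat.card_congr (MonoidHom.ofInjective hinj).toEquiv, hV,
    ← pow_add]

theorem exists_map_power_dotProduct (φ : G ≃* G) :
    ∃ d : ZMod p, ∀ g h, c.power (c.coord (φ g)) ⬝ᵥ c.coord (φ h) =
      d * (c.power (c.coord g) ⬝ᵥ c.coord h) := by
  choose x hx using fun i : Fin 3 => c.coord_surjective (Pi.single i 1)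
  set y : Fin 3 → Fin 3 → ZMod p := fun i => c.coord (φ (x i)) with hy
  have hcoord : ∀ g, c.coord (φ g) = c.coord g 0 • y 0 + c.coord g 1 • y 1 + c.coord g 2 • y 2 := by
    refine induction_of_coord c.coord_mul hx (fun g hg => ?_) (fun i => ?_) fun a b ha hb => ?_
    · have : φ g ∈ Subgroup.center G := by
        rw [Subgroup.mem_center_iff]
        intro k
        obtain ⟨k, rfl⟩ := φ.surjective k
        rw [← map_mul, ← map_mul, Subgroup.mem_center_iff.mp (c.mem_center_iff.mpr hg) k]
      rw [c.mem_center_iff.mp this, hg]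
      simp
    · rw [hx]
      fin_cases i <;> simp [hy]
    · rw [map_mul, c.coord_mul, c.coord_mul, ha, hb]
      simp only [Pi.add_apply, add_smul]
      abel
  have hcen1 : ∀ i, φ (c.cen (Pi.single i 1)) = c.cen (y (i + 1) ⨯₃ y (i + 2)) := by
    intro i
    have h := single_cross_single_succ (R := ZMod p) (i + 1)
    rw [show i + 1 + 2 = i by fin_cases i <;> rfl,
      show i + 1 + 1 = i + 2 by fin_cases i <;> rfl] at h
    rw [← h, ← hx, ← hx, ← c.commutatorElement_eq, map_commutatorElement, c.commutatorElement_eq]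
  have hcen : ∀ w, φ (c.cen w) =
      c.cen (w 0 • y 1 ⨯₃ y 2 + w 1 • y 2 ⨯₃ y 0 + w 2 • y 0 ⨯₃ y 1) := by
    intro w
    conv_lhs => rw [eq_smul_single_add w]
    simp only [c.cen_add, map_mul, map_smul_eq_pow c.cen_add, map_pow, hcen1]
    rfl
  refine ⟨y 0 ⬝ᵥ y 1 ⨯₃ y 2, fun g h => ?_⟩
  have hpow := hcen (c.power (c.coord g))
  rw [← c.pow_eq, map_pow, c.pow_eq] at hpow
  rw [c.cen_injective hpow, hcoord h]
  generalize c.power (c.coord g) = w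
  generalize c.coord h = v
  generalize y 0 = y0
  generalize y 1 = y1
  generalize y 2 = y2
  simp only [cross_apply, dotProduct, Fin.sum_univ_three, Pi.add_apply, Pi.smul_apply, smul_eq_mul,
    Matrix.cons_val]
  ring

variable [Finite G]

theorem coord_eq_zero_or_eq_top (h : IsUCS3Gen p G) {C : Subgroup G} (hC : C.Characteristic) :
    (∀ g ∈ C, c.coord g = 0) ∨ C = ⊤ := by
  rcases h.characteristic_cases hC with rfl | rfl | rfl
  · exact .inl fun g hg => by rw [Subgroup.mem_bot.mp hg, c.coord_one]
  · exact .inl fun g hg => c.mem_center_iff.mp (h.center_eq ▸ hg)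
  · exact .inr rfl

theorem power_injective (h : IsUCS3Gen p G) (h0 : c.power ≠ 0) : Function.Injective c.power := by
  let C : Subgroup G := (c.power.toAddMonoidHom.toMultiplicative.comp c.coordHom).ker
  have hmem : ∀ g, g ∈ C ↔ c.power (c.coord g) = 0 := fun g => Iff.rfl
  have hmem' : ∀ g, g ∈ C ↔ g ^ p = 1 := fun g => by
    rw [hmem, c.pow_eq, ← c.cen_zero, c.cen_injective.eq_iff]
  have hC : C.Characteristic := by
    rw [Subgroup.characteristic_iff_le_comap]
    intro φ g hg
    rw [hmem'] at hg
    rw [Subgroup.mem_comap, hmem', ← map_pow, hg, map_one]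
  rw [injective_iff_map_eq_zero]
  intro a ha
  obtain ⟨g, rfl⟩ := c.coord_surjective a
  rcases c.coord_eq_zero_or_eq_top h hC with h' | h'
  · exact h' g ((hmem g).mpr ha)
  · refine absurd (LinearMap.ext fun b => ?_) h0
    obtain ⟨k, rfl⟩ := c.coord_surjective b
    exact (hmem k).mp (h' ▸ Subgroup.mem_top k)

theorem power_dotProduct_comm (h : IsUCS3Gen p G) (a b : Fin 3 → ZMod p) :
    c.power a ⬝ᵥ b = c.power b ⬝ᵥ a := by
  let R : Subgroup G :=
    { carrier := {g | ∀ k, c.power (c.coord g) ⬝ᵥ c.coord k = c.power (c.coord k) ⬝ᵥ c.coord g}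
      one_mem' := fun k => by simp [c.coord_one]
      mul_mem' := fun ha hb k => by
        rw [c.coord_mul, map_add, add_dotProduct, dotProduct_add, ha, hb]
      inv_mem' := fun ha k => by
        rw [c.coord_inv, map_neg, neg_dotProduct, dotProduct_neg, ha] }
  have hmem : ∀ g, g ∈ R ↔
    ∀ k, c.power (c.coord g) ⬝ᵥ c.coord k = c.power (c.coord k) ⬝ᵥ c.coord g := fun g => Iff.rfl
  have hR : R.Characteristic := by
    rw [Subgroup.characteristic_iff_le_comap]
    intro φ g hg
    obtain ⟨d, hd⟩ := c.exists_map_power_dotProduct φ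
    rw [Subgroup.mem_comap, hmem]
    intro k
    obtain ⟨k, rfl⟩ := φ.surjective k
    change c.power (c.coord (φ g)) ⬝ᵥ _ = _ ⬝ᵥ c.coord (φ g)
    rw [hd, hd, (hmem g).mp hg]
  obtain ⟨s, hs⟩ := c.power.exists_dotProduct_sub_eq
  rcases c.coord_eq_zero_or_eq_top h hR with h' | h'
  · obtain ⟨g, rfl⟩ := c.coord_surjective s
    have hg := h' g ((hmem g).mpr fun k => sub_eq_zero.mp (by rw [hs, dot_self_cross]))
    rw [← sub_eq_zero, hs, hg, zero_dotProduct]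
  · obtain ⟨g, rfl⟩ := c.coord_surjective a
    obtain ⟨k, rfl⟩ := c.coord_surjective b
    exact (hmem g).mp (h' ▸ Subgroup.mem_top g) k

end CommutatorCoordinates

end SymmetricPower

section CrossBasis

open scoped Matrix

theorem FiniteField.exists_mul_sq_add_mul_sq_eq {F : Type*} [Field F] [Fintype F]
    (h2 : (2 : F) ≠ 0) {a b : F} (ha : a ≠ 0) (hb : b ≠ 0) (c : F) :
    ∃ x y : F, a * x ^ 2 + b * y ^ 2 = c := by
  classical
  have hodd : Fintype.card F % 2 = 1 := by
    refine FiniteField.odd_card_of_char_ne_two fun h => h2 ?_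
    have : CharP F 2 := h ▸ ringChar.charP F
    exact_mod_cast CharP.cast_eq_zero F 2
  obtain ⟨x, y, h⟩ := FiniteField.exists_root_sum_quadratic
    (f := Polynomial.C a * Polynomial.X ^ 2 + Polynomial.C 0 * Polynomial.X + Polynomial.C 0)
    (g := Polynomial.C b * Polynomial.X ^ 2 + Polynomial.C 0 * Polynomial.X + Polynomial.C (-c))
    (Polynomial.degree_quadratic ha) (Polynomial.degree_quadratic hb) hodd
  refine ⟨x, y, ?_⟩
  simp at h
  linear_combination h

/-- Over a finite field of odd characteristic a nondegenerate symmetric form on a `3`-dimensional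
space is a multiple of the standard one. -/
theorem exists_orthogonal_of_symmetric {F : Type*} [Field F] [Fintype F] (h2 : (2 : F) ≠ 0)
    {q : (Fin 3 → F) →ₗ[F] (Fin 3 → F)} (hinj : Function.Injective q)
    (hsymm : ∀ a b, q a ⬝ᵥ b = q b ⬝ᵥ a) :
    ∃ (v : Fin 3 → Fin 3 → F) (d : F), d ≠ 0 ∧
      ∀ i j, q (v i) ⬝ᵥ v j = if i = j then d else 0 := by
  classical
  let B : LinearMap.BilinForm F (Fin 3 → F) := (dotProductBilin F F).comp q
  have hB : ∀ a b, B a b = q a ⬝ᵥ b := fun a b => rfl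
  have : Invertible (2 : F) := invertibleOfNonzero h2
  have hBs : LinearMap.IsSymm B := ⟨fun a b => by simpa [hB] using hsymm a b⟩
  obtain ⟨w', hw'⟩ := LinearMap.BilinForm.exists_orthogonal_basis hBs
  let w := w'.reindex (finCongr (Module.finrank_fin_fun (n := 3) F))
  have hw : ∀ i j, i ≠ j → q (w i) ⬝ᵥ w j = 0 := by
    intro i j hij
    rw [← hB]
    simp only [w, Module.Basis.reindex_apply]
    exact hw' (by simpa using hij)
  have hd : ∀ i, q (w i) ⬝ᵥ w i ≠ 0 := by
    intro i hi
    refine w.ne_zero i (hinj ?_)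
    rw [map_zero]
    refine dotProduct_eq_zero _ fun a => ?_
    rw [← w.sum_repr a, dotProduct_sum]
    refine Finset.sum_eq_zero fun j _ => ?_
    rw [dotProduct_smul]
    by_cases h : i = j
    · rw [← h, hi, smul_zero]
    · rw [hw i j h, smul_zero]
  set d := fun i => q (w i) ⬝ᵥ w i with hdd
  have hwd : ∀ i, q (w i) ⬝ᵥ w i = d i := fun i => rfl
  obtain ⟨x, y, hxy⟩ := FiniteField.exists_mul_sq_add_mul_sq_eq h2 (hd 0) (hd 1) (d 0 * d 1 * d 2)
  obtain ⟨X, Y, hXY⟩ :=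
    FiniteField.exists_mul_sq_add_mul_sq_eq h2 (hd 2) (hd 2) (d 0 * d 1 * d 2)
  change d 0 * x ^ 2 + d 1 * y ^ 2 = _ at hxy
  change d 2 * X ^ 2 + d 2 * Y ^ 2 = _ at hXY
  let v' := (d 0 * d 1)⁻¹ • (-(d 1 * y) • w 0 + (d 0 * x) • w 1)
  refine ⟨![x • w 0 + y • w 1, X • v' + Y • w 2, -Y • v' + X • w 2], d 0 * d 1 * d 2,
    mul_ne_zero (mul_ne_zero (hd 0) (hd 1)) (hd 2), ?_⟩
  have h0 := hd 0
  have h1 := hd 1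
  rw [hwd] at h0 h1
  have e01 := hw 0 1 (by decide)
  have e02 := hw 0 2 (by decide)
  have e12 := hw 1 2 (by decide)
  have e10 := hw 1 0 (by decide)
  have e20 := hw 2 0 (by decide)
  have e21 := hw 2 1 (by decide)
  have hv' : (d 0 * d 1)⁻¹ * (d 0 * d 1)⁻¹ * (d 0 * (d 1 * y) ^ 2 + d 1 * (d 0 * x) ^ 2) = d 2 := by
    field_simp
    linear_combination hxy
  intro i j
  fin_cases i <;> fin_cases j <;>
    simp [v', add_dotProduct, dotProduct_add, e01, e02, e12, e10, e20, e21, hwd]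
  · linear_combination hxy
  · ring
  · ring
  · ring
  · linear_combination X ^ 2 * hv' + hXY
  · linear_combination -X * Y * hv'
  · ring
  · linear_combination -X * Y * hv'
  · linear_combination Y ^ 2 * hv' + hXY

theorem exists_two_smul_eq_cross_of_symmetric {F : Type*} [Field F] [Fintype F] (h2 : (2 : F) ≠ 0)
    {q : (Fin 3 → F) →ₗ[F] (Fin 3 → F)} (hinj : Function.Injective q)
    (hsymm : ∀ a b, q a ⬝ᵥ b = q b ⬝ᵥ a) :
    ∃ u : Fin 3 → Fin 3 → F, (∀ a, ∃ t : Fin 3 → F, a = t 0 • u 0 + t 1 • u 1 + t 2 • u 2) ∧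
      ∀ i, (2 : F) • q (u i) = u (i + 1) ⨯₃ u (i + 2) := by
  obtain ⟨v, d, hd, hv⟩ := exists_orthogonal_of_symmetric h2 hinj hsymm
  set D := v 0 ⬝ᵥ v 1 ⨯₃ v 2 with hDdef
  have hexp : ∀ w, D • w = (w ⬝ᵥ v 0) • (v 1 ⨯₃ v 2) + (w ⬝ᵥ v 1) • (v 2 ⨯₃ v 0) +
      (w ⬝ᵥ v 2) • (v 0 ⨯₃ v 1) := by
    intro w
    ext i
    rw [hDdef]
    fin_cases i <;>
      simp only [cross_apply, dotProduct, Fin.sum_univ_three, Pi.add_apply, Pi.smul_apply,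
        smul_eq_mul, Matrix.cons_val, Fin.zero_eta, Fin.mk_one, Fin.reduceFinMk] <;> ring
  have hexp' : ∀ w, D • w = (w ⬝ᵥ v 1 ⨯₃ v 2) • v 0 + (w ⬝ᵥ v 2 ⨯₃ v 0) • v 1 +
      (w ⬝ᵥ v 0 ⨯₃ v 1) • v 2 := by
    intro w
    ext i
    rw [hDdef]
    fin_cases i <;>
      simp only [cross_apply, dotProduct, Fin.sum_univ_three, Pi.add_apply, Pi.smul_apply,
        smul_eq_mul, Matrix.cons_val, Fin.zero_eta, Fin.mk_one, Fin.reduceFinMk] <;> ring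
  have hq : ∀ i, D • q (v i) = d • v (i + 1) ⨯₃ v (i + 2) := by
    intro i
    rw [hexp, hv, hv, hv]
    fin_cases i <;> simp
  have hD : D ≠ 0 := by
    intro hD
    have h := hq 0
    rw [hD, zero_smul, eq_comm, smul_eq_zero_iff_right hd] at h
    have h' := cross_cross_eq_smul_sub_smul (v 1) (v 2) (q (v 1))
    rw [show v 1 ⨯₃ v 2 = 0 from h, map_zero, LinearMap.zero_apply, dotProduct_comm, hv,
      dotProduct_comm, hv, if_pos rfl, if_neg (by decide), zero_smul, sub_zero, eq_comm,
      smul_eq_zero_iff_right hd] at h'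
    have h22 := hv 2 2
    rw [h', dotProduct_zero, if_pos rfl] at h22
    exact hd h22.symm
  refine ⟨fun i => (2 * (d / D)) • v i, fun a => ?_, fun i => ?_⟩
  · refine ⟨![(a ⬝ᵥ v 1 ⨯₃ v 2) / (2 * d), (a ⬝ᵥ v 2 ⨯₃ v 0) / (2 * d),
      (a ⬝ᵥ v 0 ⨯₃ v 1) / (2 * d)], ?_⟩
    have h := congrArg (D⁻¹ • ·) (hexp' a)
    simp only [smul_smul, inv_mul_cancel₀ hD, one_smul, smul_add] at h
    have hc : ∀ x : F, x / (2 * d) * (2 * (d / D)) = D⁻¹ * x := fun x => by field_simp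
    simp only [smul_smul, Matrix.cons_val, hc]
    exact h
  · simp only [map_smul, LinearMap.smul_apply, smul_smul]
    have h := congrArg (D⁻¹ • ·) (hq i)
    simp only [smul_smul, inv_mul_cancel₀ hD, one_smul] at h
    rw [h, smul_smul]
    congr 1
    field_simp

end CrossBasis

section CrossHeisenberg

open scoped Matrix commutatorElement

/-- The Heisenberg-type group on pairs of integer vectors, with product twisted by the cross
product. -/
@[ext] structure CrossHeisenberg where
  /-- the noncentral component -/
  vec : Fin 3 → ℤ
  /-- the central component -/
  cen : Fin 3 → ℤ

namespace CrossHeisenberg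

instance : Mul CrossHeisenberg := ⟨fun g h => ⟨g.vec + h.vec, g.cen + h.cen + g.vec ⨯₃ h.vec⟩⟩

instance : One CrossHeisenberg := ⟨⟨0, 0⟩⟩

instance : Inv CrossHeisenberg := ⟨fun g => ⟨-g.vec, -g.cen⟩⟩

@[simp] theorem vec_mul (g h : CrossHeisenberg) : (g * h).vec = g.vec + h.vec := rfl

@[simp] theorem cen_mul (g h : CrossHeisenberg) :
    (g * h).cen = g.cen + h.cen + g.vec ⨯₃ h.vec := rfl

@[simp] theorem vec_one : (1 : CrossHeisenberg).vec = 0 := rfl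

@[simp] theorem cen_one : (1 : CrossHeisenberg).cen = 0 := rfl

@[simp] theorem vec_inv (g : CrossHeisenberg) : g⁻¹.vec = -g.vec := rfl

@[simp] theorem cen_inv (g : CrossHeisenberg) : g⁻¹.cen = -g.cen := rfl

instance : Group CrossHeisenberg :=
  Group.ofLeftAxioms
    (fun a b c => by
      ext1
      · simp [add_assoc]
      · simp only [vec_mul, cen_mul, map_add, LinearMap.add_apply]
        abel)
    (fun a => by ext1 <;> simp)
    (fun a => by ext1 <;> simp)

theorem pow_eq (g : CrossHeisenberg) (n : ℕ) : g ^ n = ⟨n • g.vec, n • g.cen⟩ := by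
  induction n with
  | zero => ext1 <;> simp
  | succ n ih =>
    rw [pow_succ, ih]
    ext1
    · simp [add_smul]
    · simp only [cen_mul, map_nsmul, LinearMap.smul_apply, cross_self, smul_zero, add_zero,
        add_smul, one_smul]

theorem commutatorElement_eq (g h : CrossHeisenberg) :
    ⁅g, h⁆ = ⟨0, 2 • g.vec ⨯₃ h.vec⟩ := by
  rw [commutatorElement_def]
  ext1
  · simp
  · have := cross_anticomm g.vec h.vec
    simp only [cen_mul, vec_mul, cen_inv, vec_inv, map_add, map_neg, LinearMap.add_apply,
      LinearMap.neg_apply, cross_self, ← this]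
    abel

/-- The automorphism induced by an additive automorphism preserving the cross product. -/
def mapEquiv (e : (Fin 3 → ℤ) ≃+ (Fin 3 → ℤ)) (he : ∀ a b, e (a ⨯₃ b) = e a ⨯₃ e b) :
    CrossHeisenberg ≃* CrossHeisenberg where
  toFun g := ⟨e g.vec, e g.cen⟩
  invFun g := ⟨e.symm g.vec, e.symm g.cen⟩
  left_inv g := by simp
  right_inv g := by simp
  map_mul' g h := by ext1 <;> simp [he]

/-- The automorphism permuting the coordinates cyclically. -/
def rotate (k : Fin 3) : CrossHeisenberg ≃* CrossHeisenberg :=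
  mapEquiv
    { toFun := fun a i => a (i + k)
      invFun := fun a i => a (i - k)
      left_inv := fun a => by simp
      right_inv := fun a => by simp
      map_add' := fun a b => rfl } fun a b => by
    rw [cross_apply, cross_apply]
    ext i
    fin_cases i <;> fin_cases k <;> rfl

/-- The automorphism changing the signs of the last two coordinates. -/
def flip : CrossHeisenberg ≃* CrossHeisenberg :=
  mapEquiv
    { toFun := fun a => ![1, -1, -1] * a
      invFun := fun a => ![1, -1, -1] * a
      left_inv := fun a => by ext i; fin_cases i <;> simp
      right_inv := fun a => by ext i; fin_cases i <;> simp
      map_add' := fun a b => mul_add _ _ _ } fun a b => by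
    change ![1, -1, -1] * (a ⨯₃ b) = (![1, -1, -1] * a) ⨯₃ (![1, -1, -1] * b)
    ext i
    fin_cases i <;> simp [cross_apply] <;> ring

variable (p : ℕ) (ε : ℤ)

/-- The normal subgroup whose quotient imposes that the `p`-th powers of the standard generators
are the `ε`-th powers of the standard central elements. -/
def relations : Subgroup CrossHeisenberg where
  carrier := {g | ∀ i, (p : ℤ) ∣ g.vec i ∧ (p : ℤ) ^ 2 ∣ p * g.cen i + ε * g.vec i}
  one_mem' i := by simp
  inv_mem' {g} hg i := by
    obtain ⟨h1, h2⟩ := hg i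
    refine ⟨by simpa using h1, ?_⟩
    refine h2.neg_right.trans (dvd_of_eq ?_)
    simp only [vec_inv, cen_inv, Pi.neg_apply]
    ring
  mul_mem' {g h} hg hh i := by
    refine ⟨dvd_add (hg i).1 (hh i).1, ?_⟩
    have hc : (p : ℤ) ^ 2 ∣ (g.vec ⨯₃ h.vec) i := by
      have hm : ∀ i j, (p : ℤ) ^ 2 ∣ g.vec i * h.vec j := fun i j => by
        rw [sq]
        exact mul_dvd_mul (hg i).1 (hh j).1
      rw [cross_apply]
      fin_cases i <;> exact dvd_sub (hm _ _) (hm _ _)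
    refine (dvd_add (dvd_add (hg i).2 (hh i).2) (hc.mul_left p)).trans (dvd_of_eq ?_)
    simp only [vec_mul, cen_mul, Pi.add_apply]
    ring

variable {p ε}

theorem mem_relations {g : CrossHeisenberg} : g ∈ relations p ε ↔
    ∀ i, (p : ℤ) ∣ g.vec i ∧ (p : ℤ) ^ 2 ∣ p * g.cen i + ε * g.vec i := Iff.rfl

theorem dvd_cross_apply {n : ℤ} (a : Fin 3 → ℤ) {b : Fin 3 → ℤ} (hb : ∀ i, n ∣ b i) (i : Fin 3) :
    n ∣ (a ⨯₃ b) i := by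
  rw [cross_apply]
  fin_cases i <;> exact dvd_sub ((hb _).mul_left _) ((hb _).mul_left _)

instance : (relations p ε).Normal where
  conj_mem g hg k i := by
    refine ⟨by simpa using (hg i).1, ?_⟩
    have hc : (p : ℤ) ^ 2 ∣ p * (k.vec ⨯₃ g.vec) i := by
      rw [sq]
      exact mul_dvd_mul_left _ (dvd_cross_apply _ (fun i => (hg i).1) i)
    have hk : (p : ℤ) * (k * g * k⁻¹).cen i + ε * (k * g * k⁻¹).vec i =
        p * g.cen i + ε * g.vec i + 2 * (p * (k.vec ⨯₃ g.vec) i) := by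
      have := congrFun (cross_anticomm k.vec g.vec) i
      simp only [vec_mul, cen_mul, vec_inv, cen_inv, map_add, map_neg, LinearMap.add_apply,
        cross_self, Pi.add_apply, Pi.neg_apply, Pi.zero_apply] at this ⊢
      rw [← this]
      ring
    rw [hk]
    exact dvd_add (hg i).2 (hc.mul_left 2)

theorem rotate_mem_relations {k : Fin 3} {g : CrossHeisenberg} :
    rotate k g ∈ relations p ε ↔ g ∈ relations p ε := by
  exact (Equiv.addRight k).forall_congr_right
    (q := fun i => (p : ℤ) ∣ g.vec i ∧ (p : ℤ) ^ 2 ∣ p * g.cen i + ε * g.vec i)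

theorem flip_mem_relations {g : CrossHeisenberg} :
    flip g ∈ relations p ε ↔ g ∈ relations p ε := by
  have hs : ∀ i, IsUnit ((![1, -1, -1] : Fin 3 → ℤ) i) := by
    intro i
    fin_cases i <;> simp
  rw [mem_relations, mem_relations]
  refine forall_congr' fun i => ?_
  rw [← (hs i).dvd_mul_left (b := g.vec i),
    ← (hs i).dvd_mul_left (b := p * g.cen i + ε * g.vec i), mul_add, mul_left_comm,
    mul_left_comm _ ε]
  rfl

theorem rotate_mk_single (j : Fin 3) (n m : ℤ) :
    rotate (-j) ⟨Pi.single 0 n, Pi.single 0 m⟩ = ⟨Pi.single j n, Pi.single j m⟩ := by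
  have h : ∀ n : ℤ, (fun i => (Pi.single 0 n : Fin 3 → ℤ) (i + -j)) = Pi.single j n := by
    intro n
    ext i
    fin_cases i <;> fin_cases j <;> rfl
  exact CrossHeisenberg.ext (h n) (h m)

theorem add_flip (a : Fin 3 → ℤ) : a + ![1, -1, -1] * a = Pi.single 0 (2 * a 0) := by
  ext i
  fin_cases i <;> simp [two_mul]

theorem _root_.AddSubgroup.eq_top_of_single_mem {n m : ℤ} (hnm : IsCoprime n m)
    {A : AddSubgroup (Fin 3 → ℤ)} (hn : ∀ j, Pi.single j n ∈ A) (hm : ∀ j, Pi.single j m ∈ A) :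
    A = ⊤ := by
  obtain ⟨r, s, hrs⟩ := hnm
  have h1 : ∀ j, Pi.single j 1 ∈ A := fun j => by
    rw [← hrs, Pi.single_add, ← smul_eq_mul, ← smul_eq_mul, Pi.single_smul, Pi.single_smul]
    exact add_mem (zsmul_mem (hn j) r) (zsmul_mem (hm j) s)
  refine (AddSubgroup.eq_top_iff' A).mpr fun v => ?_
  rw [eq_smul_single_add v]
  exact add_mem (add_mem (zsmul_mem (h1 0) _) (zsmul_mem (h1 1) _)) (zsmul_mem (h1 2) _)

theorem not_intCast_dvd_two (hp : p.Prime) (hodd : Odd p) : ¬ (p : ℤ) ∣ 2 := fun h => by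
  have := (Nat.prime_dvd_prime_iff_eq hp Nat.prime_two).mp (by exact_mod_cast h)
  subst this
  exact absurd hodd (by decide)

variable {D : Subgroup CrossHeisenberg}

theorem mk_zero_mem_of_mem (hp : p.Prime) (hodd : Odd p) (hK : relations p ε ≤ D)
    (hrot : ∀ k, ∀ g ∈ D, rotate k g ∈ D) (hflip : ∀ g ∈ D, flip g ∈ D) {w : Fin 3 → ℤ}
    (hw : ⟨0, w⟩ ∈ D) {i : Fin 3} (hi : ¬ (p : ℤ) ∣ w i) (v : Fin 3 → ℤ) : ⟨0, v⟩ ∈ D := by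
  let A : AddSubgroup (Fin 3 → ℤ) :=
    { carrier := {v | (⟨0, v⟩ : CrossHeisenberg) ∈ D}
      zero_mem' := D.one_mem
      add_mem' := fun {a b} ha hb => by
        have := D.mul_mem ha hb
        rwa [show (⟨0, a⟩ * ⟨0, b⟩ : CrossHeisenberg) = ⟨0, a + b⟩ by ext1 <;> simp] at this
      neg_mem' := fun {a} ha => by
        have := D.inv_mem ha
        rwa [show (⟨0, a⟩⁻¹ : CrossHeisenberg) = ⟨0, -a⟩ by ext1 <;> simp] at this }
  suffices A = ⊤ from (AddSubgroup.eq_top_iff' A).mp this v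
  have hpp : Prime (p : ℤ) := Nat.prime_iff_prime_int.mp hp
  have h2 := not_intCast_dvd_two hp hodd
  refine AddSubgroup.eq_top_of_single_mem (n := 2 * w i) (m := p) ?_ (fun j => ?_) fun j => ?_
  · rw [isCoprime_comm, hpp.irreducible.coprime_iff_not_dvd, hpp.dvd_mul]
    tauto
  · have h := hrot i _ hw
    have h' := hrot (-j) _ (mul_mem h (hflip _ h))
    have he : rotate i ⟨0, w⟩ * flip (rotate i ⟨0, w⟩) =
        ⟨Pi.single 0 0, Pi.single 0 (2 * w i)⟩ := by
      ext1
      · exact (add_flip _).trans (by simp [rotate, mapEquiv])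
      · change (fun k => w (k + i)) + ![1, -1, -1] * (fun k => w (k + i)) +
          0 ⨯₃ (![1, -1, -1] * 0) = _
        rw [map_zero, LinearMap.zero_apply, add_zero, add_flip, zero_add]
    rw [he, rotate_mk_single, Pi.single_zero] at h'
    exact h'
  · refine hK fun k => ⟨dvd_zero _, ?_⟩
    have : (p : ℤ) ∣ (Pi.single j (p : ℤ) : Fin 3 → ℤ) k := by
      rw [Pi.single_apply]
      split_ifs <;> simp
    change (p : ℤ) ^ 2 ∣ p * (Pi.single j (p : ℤ) : Fin 3 → ℤ) k + ε * 0
    rw [mul_zero, add_zero, sq]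
    exact mul_dvd_mul_left _ this

theorem eq_top_of_not_dvd (hp : p.Prime) (hodd : Odd p) (hK : relations p ε ≤ D)
    (hrot : ∀ k, ∀ g ∈ D, rotate k g ∈ D) (hflip : ∀ g ∈ D, flip g ∈ D) {g : CrossHeisenberg}
    (hg : g ∈ D) {i : Fin 3} (hi : ¬ (p : ℤ) ∣ g.vec i) : D = ⊤ := by
  have hpp : Prime (p : ℤ) := Nat.prime_iff_prime_int.mp hp
  have h2 := not_intCast_dvd_two hp hodd
  set n := 2 * g.vec i with hn
  have hpn : ¬ (p : ℤ) ∣ n := by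
    rw [hpp.dvd_mul]
    tauto
  have hmem := hrot i _ hg
  have hk := mul_mem hmem (hflip _ hmem)
  set k := rotate i g * flip (rotate i g) with hkdef
  have hkv : k.vec = Pi.single 0 n := (add_flip _).trans (by simp [hn, rotate, mapEquiv])
  have hcomm : ⁅k, rotate 2 k⁆ ∈ D :=
    mul_mem (mul_mem (mul_mem hk (hrot 2 _ hk)) (inv_mem hk)) (inv_mem (hrot 2 _ hk))
  have hrv : (rotate 2 k).vec = Pi.single 1 n := by
    change (fun i => k.vec (i + 2)) = _
    rw [hkv]
    ext j
    fin_cases j <;> rfl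
  rw [commutatorElement_eq, hkv, hrv] at hcomm
  have hcen : ∀ v, (⟨0, v⟩ : CrossHeisenberg) ∈ D :=
    mk_zero_mem_of_mem hp hodd hK hrot hflip hcomm (i := 2) (by
      simp [cross_apply]
      rw [hpp.dvd_mul, hpp.dvd_mul]
      tauto)
  have hzero : ∀ {g : CrossHeisenberg}, g ∈ D ↔ (⟨g.vec, 0⟩ : CrossHeisenberg) ∈ D := fun {g} => by
    have hg : g = ⟨g.vec, 0⟩ * ⟨0, g.cen⟩ := by ext1 <;> simp
    conv_lhs => rw [hg]
    exact D.mul_mem_cancel_right (hcen g.cen)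
  let A : AddSubgroup (Fin 3 → ℤ) :=
    { carrier := {v | (⟨v, 0⟩ : CrossHeisenberg) ∈ D}
      zero_mem' := D.one_mem
      add_mem' := fun {a b} ha hb => hzero.mp (D.mul_mem ha hb)
      neg_mem' := fun {a} ha => hzero.mp (D.inv_mem ha) }
  have hA : A = ⊤ := by
    refine AddSubgroup.eq_top_of_single_mem (n := n) (m := p) ?_ (fun j => ?_) fun j => ?_
    · rwa [isCoprime_comm, hpp.irreducible.coprime_iff_not_dvd]
    · have h := hrot (-j) _ (hzero.mp hk)
      rw [hkv, ← Pi.single_zero 0, rotate_mk_single, Pi.single_zero] at h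
      exact h
    · have h : (⟨Pi.single j p, Pi.single j (-ε)⟩ : CrossHeisenberg) ∈ D := by
        refine hK fun k => ?_
        by_cases h : k = j
        · subst h
          simp [mul_comm]
        · simp [h]
      exact hzero.mp h
  exact (Subgroup.eq_top_iff' D).mpr fun g =>
    hzero.mpr ((AddSubgroup.eq_top_iff' A).mp hA g.vec)

variable (p) in
/-- Reduction of the noncentral component modulo `p`. -/
def reduce : CrossHeisenberg →* Multiplicative (Fin 3 → ZMod p) :=
  MonoidHom.mk' (fun g => .ofAdd fun i => (g.vec i : ZMod p)) fun g h => by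
    rw [← ofAdd_add]
    congr 1
    ext i
    simp

theorem mem_ker_reduce {g : CrossHeisenberg} : g ∈ (reduce p).ker ↔ ∀ i, (p : ℤ) ∣ g.vec i := by
  simp_rw [← ZMod.intCast_zmod_eq_zero_iff_dvd]
  exact ⟨fun h i => congrFun (congrArg Multiplicative.toAdd h) i,
    fun h => congrArg Multiplicative.ofAdd (funext h)⟩

theorem trichotomy (hp : p.Prime) (hodd : Odd p) (hK : relations p ε ≤ D)
    (hrot : ∀ k, ∀ g ∈ D, rotate k g ∈ D) (hflip : ∀ g ∈ D, flip g ∈ D) :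
    D = relations p ε ∨ D = (reduce p).ker ∨ D = ⊤ := by
  by_cases hP : D ≤ (reduce p).ker
  swap
  · obtain ⟨g, hg, hg'⟩ := SetLike.not_le_iff_exists.mp hP
    rw [mem_ker_reduce, not_forall] at hg'
    obtain ⟨i, hi⟩ := hg'
    exact .inr (.inr (eq_top_of_not_dvd hp hodd hK hrot hflip hg hi))
  by_cases hR : D ≤ relations p ε
  · exact .inl (le_antisymm hR hK)
  refine .inr (.inl (le_antisymm hP ?_))
  have hdecomp : ∀ g ∈ (reduce p).ker, ∃ w : Fin 3 → ℤ, ∃ k ∈ relations p ε, g = ⟨0, w⟩ * k := by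
    intro g hg
    choose a ha using mem_ker_reduce.mp hg
    refine ⟨g.cen + ε • a, ⟨g.vec, -ε • a⟩, fun i => ⟨⟨_, ha i⟩, ?_⟩, ?_⟩
    · simp [ha i, ← mul_assoc, mul_comm]
    · ext1 <;> simp
  obtain ⟨g, hg, hg'⟩ := SetLike.not_le_iff_exists.mp hR
  obtain ⟨w, k, hk, rfl⟩ := hdecomp g (hP hg)
  rw [D.mul_mem_cancel_right (hK hk)] at hg
  have : ∃ i, ¬ (p : ℤ) ∣ w i := by
    by_contra! h
    refine hg' (mul_mem (fun i => ⟨dvd_zero _, ?_⟩) hk)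
    simpa [sq] using mul_dvd_mul_left (p : ℤ) (h i)
  obtain ⟨i, hi⟩ := this
  intro g' hg'
  obtain ⟨w', k', hk', rfl⟩ := hdecomp g' hg'
  exact mul_mem (mk_zero_mem_of_mem hp hodd hK hrot hflip hg hi w') (hK hk')

theorem pow_sq_mem_relations (g : CrossHeisenberg) : g ^ p ^ 2 ∈ relations p ε := by
  rw [pow_eq]
  intro i
  simp only [Pi.smul_apply, nsmul_eq_mul, Nat.cast_pow]
  refine ⟨⟨p * g.vec i, by ring⟩, ⟨p * g.cen i + ε * g.vec i, by ring⟩⟩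

theorem finite_quotient (hp : p.Prime) : Finite (CrossHeisenberg ⧸ relations p ε) := by
  have : NeZero (p ^ 2) := ⟨pow_ne_zero 2 hp.ne_zero⟩
  let f : CrossHeisenberg ⧸ relations p ε → (Fin 3 → ZMod (p ^ 2)) × (Fin 3 → ZMod (p ^ 2)) :=
    fun m => (fun i => (m.out.vec i : ZMod (p ^ 2)), fun i => (m.out.cen i : ZMod (p ^ 2)))
  refine Finite.of_injective f fun m n hmn => ?_
  rw [← m.out_eq', ← n.out_eq', QuotientGroup.eq]
  have h1 : ∀ i, (p : ℤ) ^ 2 ∣ n.out.vec i - m.out.vec i := fun i => by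
    have := (ZMod.intCast_eq_intCast_iff_dvd_sub _ _ _).mp (congrFun (congrArg Prod.fst hmn) i)
    exact_mod_cast this
  have h2 : ∀ i, (p : ℤ) ^ 2 ∣ n.out.cen i - m.out.cen i := fun i => by
    have := (ZMod.intCast_eq_intCast_iff_dvd_sub _ _ _).mp (congrFun (congrArg Prod.snd hmn) i)
    exact_mod_cast this
  have hv : (m.out⁻¹ * n.out).vec = n.out.vec - m.out.vec := by
    rw [vec_mul, vec_inv, neg_add_eq_sub]
  have hc : (m.out⁻¹ * n.out).cen =
      n.out.cen - m.out.cen + m.out⁻¹.vec ⨯₃ (n.out.vec - m.out.vec) := by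
    rw [cen_mul, vec_inv, cen_inv, map_sub, map_neg, LinearMap.neg_apply, LinearMap.neg_apply,
      cross_self, neg_zero, sub_zero, neg_add_eq_sub]
  intro i
  rw [hv, hc]
  have h3 := dvd_cross_apply m.out⁻¹.vec (b := n.out.vec - m.out.vec) h1 i
  exact ⟨(dvd_pow_self _ two_ne_zero).trans (h1 i),
    dvd_add ((dvd_add (h2 i) h3).mul_left _) ((h1 i).mul_left _)⟩

theorem isPGroup_quotient : IsPGroup p (CrossHeisenberg ⧸ relations p ε) := by
  intro m
  induction m using QuotientGroup.induction_on with
  | H g => exact ⟨2, (QuotientGroup.eq_one_iff _).mpr (pow_sq_mem_relations g)⟩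

theorem mem_comap_of_characteristic {S : Subgroup (CrossHeisenberg ⧸ relations p ε)}
    (hS : S.Characteristic) (φ : CrossHeisenberg ≃* CrossHeisenberg)
    (hφ : ∀ g, φ g ∈ relations p ε ↔ g ∈ relations p ε) {g : CrossHeisenberg}
    (hg : g ∈ S.comap (QuotientGroup.mk' _)) : φ g ∈ S.comap (QuotientGroup.mk' _) := by
  have hmap : (relations p ε).map φ.toMonoidHom = relations p ε := by
    ext x
    rw [Subgroup.mem_map_equiv, ← hφ, MulEquiv.apply_symm_apply]
  have := Subgroup.characteristic_iff_le_comap.mp hS (QuotientGroup.congr _ _ φ hmap) hg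
  exact this

theorem isUCS3Gen_quotient (hp : p.Prime) (hodd : Odd p) :
    IsUCS3Gen p (CrossHeisenberg ⧸ relations p ε) := by
  have : Fact p.Prime := ⟨hp⟩
  have := finite_quotient (ε := ε) hp
  have hpg := isPGroup_quotient (p := p) (ε := ε)
  have hsurj := QuotientGroup.mk'_surjective (relations p ε)
  have hnc : ∃ g h : CrossHeisenberg, ⁅g, h⁆ ∉ relations p ε := by
    refine ⟨⟨Pi.single 0 1, 0⟩, ⟨Pi.single 1 1, 0⟩, fun h => ?_⟩
    have := (h 2).2
    rw [commutatorElement_eq] at this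
    have h2 : (p : ℤ) ^ 2 ∣ p * 2 := by simpa [cross_apply] using this
    rw [sq, mul_dvd_mul_iff_left (by exact_mod_cast hp.ne_zero)] at h2
    exact not_intCast_dvd_two hp hodd h2
  obtain ⟨g₁, g₂, hg⟩ := hnc
  have hne : ⁅(g₁ : CrossHeisenberg ⧸ relations p ε), (g₂ : CrossHeisenberg ⧸ relations p ε)⁆ ≠ 1 :=
    fun h => hg ((QuotientGroup.eq_one_iff _).mp h)
  have : Nontrivial (CrossHeisenberg ⧸ relations p ε) := ⟨_, _, hne⟩
  have htri : ∀ S : Subgroup (CrossHeisenberg ⧸ relations p ε), S.Characteristic →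
      S = ⊥ ∨ S.comap (QuotientGroup.mk' _) = (reduce p).ker ∨ S = ⊤ := by
    intro S hS
    rcases trichotomy (ε := ε) (D := S.comap (QuotientGroup.mk' _)) hp hodd
      (by simpa using (MonoidHom.ker_le_comap (QuotientGroup.mk' (relations p ε)) S))
      (fun k g hg => mem_comap_of_characteristic hS (rotate k) (fun _ => rotate_mem_relations) hg)
      (fun g hg => mem_comap_of_characteristic hS flip (fun _ => flip_mem_relations) hg)
      with h | h | h
    · left
      refine Subgroup.comap_injective hsurj ?_
      rw [h, MonoidHom.comap_bot, QuotientGroup.ker_mk']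
    · exact .inr (.inl h)
    · right; right
      exact Subgroup.comap_injective hsurj (by rw [h, Subgroup.comap_top])
  have hΦtop : frattini (CrossHeisenberg ⧸ relations p ε) ≠ ⊤ := frattini_ne_top
  have hΦbot : frattini (CrossHeisenberg ⧸ relations p ε) ≠ ⊥ := by
    intro h
    have := hpg.commutator_le_frattini (Subgroup.commutator_mem_commutator
      (Subgroup.mem_top (g₁ : CrossHeisenberg ⧸ relations p ε))
      (Subgroup.mem_top (g₂ : CrossHeisenberg ⧸ relations p ε)))
    rw [h, Subgroup.mem_bot] at this
    exact hne this
  have hΦ : (frattini (CrossHeisenberg ⧸ relations p ε)).comap (QuotientGroup.mk' _) =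
      (reduce p).ker := by
    rcases htri _ frattini_characteristic with h | h | h
    exacts [absurd h hΦbot, h, absurd h hΦtop]
  refine ⟨⟨hpg, ?_⟩, fun h => hne (commutatorElement_eq_one_iff_mul_comm.mpr (h _ _)), ?_⟩
  · have hset : {H : Subgroup (CrossHeisenberg ⧸ relations p ε) | H.Characteristic} =
        {⊥, frattini (CrossHeisenberg ⧸ relations p ε), ⊤} := by
      ext S
      simp only [Set.mem_ofPred_eq, Set.mem_insert_iff, Set.mem_singleton_iff]
      constructor
      · intro hS
        rcases htri S hS with h | h | h
        · exact .inl h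
        · exact .inr (.inl (Subgroup.comap_injective hsurj (h.trans hΦ.symm)))
        · exact .inr (.inr h)
      · rintro (rfl | rfl | rfl) <;> infer_instance
    change Nat.card ↥{H : Subgroup (CrossHeisenberg ⧸ relations p ε) | H.Characteristic} = 3
    rw [hset, Nat.card_coe_set_eq]
    exact Set.ncard_eq_three.mpr ⟨_, _, _, hΦbot.symm, bot_ne_top, hΦtop, rfl⟩
  · change (frattini (CrossHeisenberg ⧸ relations p ε)).index = p ^ 3
    rw [← Subgroup.index_comap_of_surjective _ hsurj, hΦ, Subgroup.index_ker]
    have hr : Function.Surjective (reduce p) := by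
      intro v
      refine ⟨⟨fun i => (v.toAdd i).cast, 0⟩, ?_⟩
      refine congrArg Multiplicative.ofAdd (funext fun i => ?_)
      exact ZMod.intCast_zmod_cast _
    rw [MonoidHom.range_eq_top.mpr hr, Subgroup.card_top]
    change Nat.card (Fin 3 → ZMod p) = p ^ 3
    rw [Nat.card_fun, Nat.card_zmod, Nat.card_fin]

theorem exponent_quotient_zero (hp : p.Prime) (hodd : Odd p) :
    Monoid.exponent (CrossHeisenberg ⧸ relations p 0) = p := by
  have h : Monoid.exponent (CrossHeisenberg ⧸ relations p 0) ∣ p := by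
    refine Monoid.exponent_dvd_of_forall_pow_eq_one fun m => ?_
    induction m using QuotientGroup.induction_on with
    | H g =>
      refine (QuotientGroup.eq_one_iff _).mpr ?_
      change g ^ p ∈ _
      rw [pow_eq]
      intro i
      simp only [Pi.smul_apply, nsmul_eq_mul]
      exact ⟨⟨g.vec i, rfl⟩, ⟨g.cen i, by ring⟩⟩
  refine ((Nat.dvd_prime hp).mp h).resolve_left fun h1 => ?_
  have := Monoid.exp_eq_one_iff.mp h1
  exact (isUCS3Gen_quotient (ε := 0) hp hodd).2.1 fun _ _ => Subsingleton.elim _ _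

theorem exponent_quotient_one (hp : p.Prime) :
    Monoid.exponent (CrossHeisenberg ⧸ relations p 1) = p ^ 2 := by
  have h : Monoid.exponent (CrossHeisenberg ⧸ relations p 1) ∣ p ^ 2 := by
    refine Monoid.exponent_dvd_of_forall_pow_eq_one fun m => ?_
    induction m using QuotientGroup.induction_on with
    | H g => exact (QuotientGroup.eq_one_iff _).mpr (pow_sq_mem_relations g)
  refine (Nat.dvd_prime_pow hp).mp h |>.elim fun k ⟨hk, hk'⟩ => ?_
  rcases hk.lt_or_eq with hk | rfl
  swap
  · exact hk'
  have h1 : (⟨Pi.single 0 1, 0⟩ : CrossHeisenberg) ^ p ∈ relations p 1 := by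
    refine (QuotientGroup.eq_one_iff _).mp ?_
    refine Monoid.exponent_dvd_iff_forall_pow_eq_one.mp ?_
      ((⟨Pi.single 0 1, 0⟩ : CrossHeisenberg) : CrossHeisenberg ⧸ relations p 1)
    rw [hk']
    exact (pow_dvd_pow p (Nat.lt_succ_iff.mp hk)).trans (pow_one p).dvd
  rw [pow_eq] at h1
  have h2 : (p : ℤ) ^ 2 ∣ p := by simpa using (h1 0).2
  have h3 : p ^ 2 ≤ p := Nat.le_of_dvd hp.pos (by exact_mod_cast h2)
  nlinarith [hp.two_le]

end CrossHeisenberg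

end CrossHeisenberg

section Classification

open scoped Matrix

namespace CommutatorCoordinates

variable {p : ℕ} {G : Type*} [Group G] (c : CommutatorCoordinates p G)

theorem coord_zpow (g : G) (n : ℤ) : c.coord (g ^ n) = n • c.coord g :=
  congrArg Multiplicative.toAdd (c.coordHom.map_zpow g n)

theorem cen_zsmul (v : Fin 3 → ZMod p) (n : ℤ) : c.cen (n • v) = c.cen v ^ n :=
  c.cenHom.map_zpow (.ofAdd v) n

theorem cen_mul_comm (v : Fin 3 → ZMod p) (g : G) : c.cen v * g = g * c.cen v := by
  rw [c.mul_swap, c.coord_cen, map_zero, LinearMap.zero_apply, c.cen_zero, one_mul]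

theorem mul_mul_mul_mul_eq (a₀ a₁ a₂ b₀ b₁ b₂ : G) :
    a₀ * a₁ * a₂ * (b₀ * b₁ * b₂) = a₀ * b₀ * (a₁ * b₁) * (a₂ * b₂) *
      c.cen (c.coord (a₁ * a₂) ⨯₃ c.coord b₀ + c.coord a₂ ⨯₃ c.coord b₁) := by
  have h₁ := c.mul_swap (a₁ * a₂) b₀
  have h₂ := c.mul_swap a₂ b₁
  rw [c.cen_mul_comm] at h₁ h₂
  set s := c.coord (a₁ * a₂) ⨯₃ c.coord b₀
  set t := c.coord a₂ ⨯₃ c.coord b₁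
  calc a₀ * a₁ * a₂ * (b₀ * b₁ * b₂) = a₀ * (a₁ * a₂ * b₀) * (b₁ * b₂) := by
        simp only [mul_assoc]
    _ = a₀ * b₀ * a₁ * a₂ * (c.cen s * (b₁ * b₂)) := by
        rw [h₁]
        simp only [mul_assoc]
    _ = a₀ * b₀ * a₁ * (a₂ * b₁) * b₂ * c.cen s := by
        rw [c.cen_mul_comm]
        simp only [mul_assoc]
    _ = a₀ * b₀ * a₁ * (b₁ * a₂) * (c.cen t * b₂) * c.cen s := by
        rw [h₂]
        simp only [mul_assoc]
    _ = _ := by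
        rw [c.cen_mul_comm, add_comm, c.cen_add]
        simp only [mul_assoc]

/-- The homomorphism from the integral group determined by elements whose commutators are the
squares of given central elements. -/
def lift (x : Fin 3 → G) (w : Fin 3 → Fin 3 → ZMod p)
    (hw : ∀ i, (2 : ZMod p) • w i = c.coord (x (i + 1)) ⨯₃ c.coord (x (i + 2))) :
    CrossHeisenberg →* G :=
  MonoidHom.mk' (fun g => x 0 ^ g.vec 0 * x 1 ^ g.vec 1 * x 2 ^ g.vec 2 *
    c.cen ((g.cen 0 - g.vec 1 * g.vec 2) • w 0 + (g.cen 1 + g.vec 0 * g.vec 2) • w 1 +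
      (g.cen 2 - g.vec 0 * g.vec 1) • w 2)) fun g h => by
    obtain ⟨a, s⟩ := g
    obtain ⟨b, t⟩ := h
    have h0 : c.coord (x 2) ⨯₃ c.coord (x 1) = -((2 : ZMod p) • w 0) := by
      rw [hw 0, ← cross_anticomm]
      rfl
    have h1 : c.coord (x 2) ⨯₃ c.coord (x 0) = (2 : ZMod p) • w 1 := (hw 1).symm
    have h2 : c.coord (x 1) ⨯₃ c.coord (x 0) = -((2 : ZMod p) • w 2) := by
      rw [hw 2, ← cross_anticomm]
      rfl
    have hX := c.mul_mul_mul_mul_eq (x 0 ^ a 0) (x 1 ^ a 1) (x 2 ^ a 2) (x 0 ^ b 0) (x 1 ^ b 1)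
      (x 2 ^ b 2)
    simp only [← zpow_add, c.coord_mul, c.coord_zpow, map_add, map_zsmul, LinearMap.add_apply,
      LinearMap.smul_apply, h0, h1, h2] at hX
    simp only [CrossHeisenberg.vec_mul, CrossHeisenberg.cen_mul, Pi.add_apply]
    rw [mul_assoc (x 0 ^ a 0 * x 1 ^ a 1 * x 2 ^ a 2), ← mul_assoc (c.cen _), c.cen_mul_comm,
      mul_assoc (x 0 ^ b 0 * x 1 ^ b 1 * x 2 ^ b 2),
      ← mul_assoc _ (x 0 ^ b 0 * x 1 ^ b 1 * x 2 ^ b 2),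
      hX, mul_assoc _ (c.cen _), ← c.cen_add, ← c.cen_add]
    congr 2
    simp only [cross_apply, Matrix.cons_val]
    module

theorem relations_le_ker_lift {x : Fin 3 → G} {w : Fin 3 → Fin 3 → ZMod p}
    (hw : ∀ i, (2 : ZMod p) • w i = c.coord (x (i + 1)) ⨯₃ c.coord (x (i + 2))) {ε : ℤ}
    (hpow : ∀ i, c.power (c.coord (x i)) = ε • w i) (hp : p ≠ 0) :
    CrossHeisenberg.relations p ε ≤ (c.lift x w hw).ker := by
  intro g hg
  choose k hk using fun i => (hg i).1
  have hx : ∀ i, x i ^ g.vec i = c.cen ((k i * ε) • w i) := fun i => by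
    rw [hk, zpow_mul, zpow_natCast, c.pow_eq, hpow, ← c.cen_zsmul, smul_smul]
  have hdvd : ∀ i, (p : ℤ) ∣ k i * ε + g.cen i := fun i => by
    have h := (hg i).2
    rw [hk, sq, mul_left_comm, ← mul_add, mul_dvd_mul_iff_left (by exact_mod_cast hp)] at h
    rwa [mul_comm, add_comm]
  have hsmul : ∀ {n : ℤ} (v : Fin 3 → ZMod p), (p : ℤ) ∣ n → n • v = 0 := fun {n} v h => by
    rw [← Int.cast_smul_eq_zsmul (ZMod p), (ZMod.intCast_zmod_eq_zero_iff_dvd n p).mpr h, zero_smul]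
  have hv : ∀ i (n : ℤ), (p : ℤ) ∣ g.vec i * n := fun i n => (hg i).1.mul_right n
  change _ * _ * _ * _ = (1 : G)
  rw [hx, hx, hx, ← c.cen_add, ← c.cen_add, ← c.cen_add, ← c.cen_zero]
  congr 1
  have e := congrArg₂ (· + ·) (congrArg₂ (· + ·)
    (hsmul (w 0) (dvd_sub (hdvd 0) (hv 1 (g.vec 2))))
    (hsmul (w 1) (dvd_add (hdvd 1) (hv 0 (g.vec 2)))))
    (hsmul (w 2) (dvd_sub (hdvd 2) (hv 0 (g.vec 1))))
  simp only [add_zero] at e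
  rw [← e]
  module

theorem nonempty_mulEquiv_quotient [Fact p.Prime] [Finite G] (hodd : Odd p) (h : IsUCS3Gen p G)
    {u w : Fin 3 → Fin 3 → ZMod p}
    (hu : ∀ a, ∃ t : Fin 3 → ZMod p, a = t 0 • u 0 + t 1 • u 1 + t 2 • u 2)
    (hw : ∀ i, (2 : ZMod p) • w i = u (i + 1) ⨯₃ u (i + 2)) {ε : ℤ}
    (hpow : ∀ i, c.power (u i) = ε • w i) :
    Nonempty (G ≃* CrossHeisenberg ⧸ CrossHeisenberg.relations p ε) := by
  have hp : p.Prime := Fact.out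
  choose x hx using fun i => c.coord_surjective (u i)
  obtain rfl : (fun i => c.coord (x i)) = u := funext hx
  have hker := c.relations_le_ker_lift hw hpow hp.ne_zero
  have hsurj : Function.Surjective (c.lift x w hw) := by
    rw [← MonoidHom.range_eq_top]
    refine frattini_nongenerating ((Subgroup.eq_top_iff' _).mpr fun g => ?_)
    obtain ⟨t, ht⟩ := hu (c.coord g)
    set a : CrossHeisenberg := ⟨fun i => (t i).cast, 0⟩ with ha
    have hcoord : c.coord (c.lift x w hw a) = c.coord g := by
      change c.coord (_ * _ * _ * _) = _
      simp only [c.coord_mul, c.coord_zpow, c.coord_cen, ht, ha, add_zero,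
        ← Int.cast_smul_eq_zsmul (ZMod p), ZMod.intCast_zmod_cast]
    have hmem : (c.lift x w hw a)⁻¹ * g ∈ frattini G := by
      rw [← h.center_eq, c.mem_center_iff, c.coord_mul, c.coord_inv, hcoord, neg_add_cancel]
    rw [← mul_inv_cancel_left (c.lift x w hw a) g]
    exact Subgroup.mul_mem_sup ⟨a, rfl⟩ hmem
  have hM := CrossHeisenberg.isUCS3Gen_quotient (ε := ε) hp hodd
  have := CrossHeisenberg.finite_quotient (ε := ε) hp
  have hcard : Nat.card (CrossHeisenberg ⧸ CrossHeisenberg.relations p ε) = Nat.card G := by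
    obtain ⟨d⟩ := hM.nonempty_commutatorCoordinates hodd
    rw [d.card_eq, c.card_eq]
  have hsurj' := QuotientGroup.lift_surjective_of_surjective _ _ hsurj hker
  exact ⟨(MulEquiv.ofBijective (QuotientGroup.lift _ _ hker)
    (hsurj'.bijective_of_nat_card_le hcard.le)).symm⟩

end CommutatorCoordinates

end Classification

theorem stmt5 (p : ℕ) (hp : p.Prime) (hodd : Odd p) :
    -- any such group has order `p⁶` and exponent `p` or `p²`
    (∀ (G : Type) [Group G] [Finite G], IsUCS3Gen p G →
        Nat.card G = p ^ 6 ∧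
          (Monoid.exponent G = p ∨ Monoid.exponent G = p ^ 2)) ∧
    -- there is, up to isomorphism, exactly one such group of exponent `p`
    (∃ (G : Type) (_ : Group G) (_ : Finite G),
        IsUCS3Gen p G ∧ Monoid.exponent G = p ∧
        ∀ (H : Type) (_ : Group H) (_ : Finite H),
          IsUCS3Gen p H → Monoid.exponent H = p → Nonempty (H ≃* G)) ∧
    -- and exactly one of exponent `p²`
    (∃ (G : Type) (_ : Group G) (_ : Finite G),
        IsUCS3Gen p G ∧ Monoid.exponent G = p ^ 2 ∧
        ∀ (H : Type) (_ : Group H) (_ : Finite H),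
          IsUCS3Gen p H → Monoid.exponent H = p ^ 2 → Nonempty (H ≃* G)) := by
  have : Fact p.Prime := ⟨hp⟩
  have h2 : (2 : ZMod p) ≠ 0 := fun h =>
    CrossHeisenberg.not_intCast_dvd_two hp hodd
      ((ZMod.intCast_zmod_eq_zero_iff_dvd 2 p).mp (by exact_mod_cast h))
  refine ⟨fun G _ _ h => ?_, ?_, ?_⟩
  · obtain ⟨c⟩ := h.nonempty_commutatorCoordinates hodd
    refine ⟨c.card_eq, ?_⟩
    obtain ⟨k, hk, hk'⟩ := (Nat.dvd_prime_pow hp).mp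
      (Monoid.exponent_dvd_of_forall_pow_eq_one c.pow_sq_eq_one)
    have hk0 : k ≠ 0 := by
      rintro rfl
      have := Monoid.exp_eq_one_iff.mp (hk'.trans (pow_zero p))
      exact h.2.1 fun _ _ => Subsingleton.elim _ _
    obtain rfl | rfl : k = 1 ∨ k = 2 := by omega
    · exact .inl (hk'.trans (pow_one p))
    · exact .inr hk'
  · refine ⟨CrossHeisenberg ⧸ CrossHeisenberg.relations p 0, inferInstance,
      CrossHeisenberg.finite_quotient hp, CrossHeisenberg.isUCS3Gen_quotient hp hodd,
      CrossHeisenberg.exponent_quotient_zero hp hodd, fun H _ _ h hexp => ?_⟩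
    obtain ⟨c⟩ := h.nonempty_commutatorCoordinates hodd
    refine c.nonempty_mulEquiv_quotient hodd h (u := fun i => Pi.single i 1)
      (w := fun i => (2 : ZMod p)⁻¹ • Pi.single i 1) (fun a => ⟨a, eq_smul_single_add a⟩)
      (fun i => ?_) fun i => ?_
    · have := single_cross_single_succ (R := ZMod p) (i + 1)
      rw [show i + 1 + 2 = i by fin_cases i <;> rfl,
        show i + 1 + 1 = i + 2 by fin_cases i <;> rfl] at this
      rw [this, smul_inv_smul₀ h2]
    · obtain ⟨g, hg⟩ := c.coord_surjective (Pi.single i 1)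
      refine c.cen_injective ?_
      rw [← hg, ← c.pow_eq, zero_smul, c.cen_zero, ← hexp, Monoid.pow_exponent_eq_one]
  · refine ⟨CrossHeisenberg ⧸ CrossHeisenberg.relations p 1, inferInstance,
      CrossHeisenberg.finite_quotient hp, CrossHeisenberg.isUCS3Gen_quotient hp hodd,
      CrossHeisenberg.exponent_quotient_one hp, fun H _ _ h hexp => ?_⟩
    obtain ⟨c⟩ := h.nonempty_commutatorCoordinates hodd
    have h0 : c.power ≠ 0 := fun h0 => by
      have hdvd : Monoid.exponent H ∣ p := Monoid.exponent_dvd_of_forall_pow_eq_one fun g => by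
        rw [c.pow_eq, h0, LinearMap.zero_apply, c.cen_zero]
      rw [hexp] at hdvd
      have := Nat.le_of_dvd hp.pos hdvd
      nlinarith [hp.two_le]
    obtain ⟨u, hu, hw⟩ := exists_two_smul_eq_cross_of_symmetric h2 (c.power_injective h h0)
      (c.power_dotProduct_comm h)
    exact c.nonempty_mulEquiv_quotient hodd h hu hw fun i => (one_zsmul _).symm
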